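/- Let 𝔽 be a field and let Q be a finite set of polynomials in 𝔽[x₁,…,x_n]. There is a PC refutation of Q (i.e., the constant polynomial 1 is PC-derivable from Q) if and only if the polynomials in Q have no common zero in {0,1}ⁿ. -/

import Mathlib

open MvPolynomial

/-- The set of polynomials PC-derivable from a finite set `Q`: the smallest set containing the
members of `Q` and the boolean axioms `x_i·(1-x_i)`, closed under the product rule
(from `p` derive `x_i·p`) and the addition rule (from `p, q` derive `a·p + b·q`). -/
inductive PCDeriv (F : Type*) [Field F] (n : ℕ) (Q : Finset (MvPolynomial (Fin n) F)) :
    MvPolynomial (Fin n) F → Prop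
  | hyp (f : MvPolynomial (Fin n) F) (hf : f ∈ Q) : PCDeriv F n Q f
  | boolAx (i : Fin n) : PCDeriv F n Q (X i * (1 - X i))
  | prod (i : Fin n) (p : MvPolynomial (Fin n) F) :
      PCDeriv F n Q p → PCDeriv F n Q (X i * p)
  | add (a b : F) (p q : MvPolynomial (Fin n) F) :
      PCDeriv F n Q p → PCDeriv F n Q q → PCDeriv F n Q (C a * p + C b * q)

theorem pc_add_or (F : Type*) [Field F] (n : ℕ) (Q : Finset (MvPolynomial (Fin n) F))
    (p q : MvPolynomial (Fin n) F) (hp : p = 0 ∨ PCDeriv F n Q p)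
    (hq : q = 0 ∨ PCDeriv F n Q q) : p + q = 0 ∨ PCDeriv F n Q (p + q) := by
  rcases hp with rfl | hp
  · simpa using hq
  rcases hq with rfl | hq
  · right; simpa using hp
  · right; simpa using PCDeriv.add 1 1 p q hp hq

theorem pc_mul_or (F : Type*) [Field F] (n : ℕ) (Q : Finset (MvPolynomial (Fin n) F))
    (a p : MvPolynomial (Fin n) F) (hp : p = 0 ∨ PCDeriv F n Q p) :
    a * p = 0 ∨ PCDeriv F n Q (a * p) := by
  rcases hp with rfl | hp
  · simp
  induction a using MvPolynomial.induction_on with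
  | C c => right; simpa using PCDeriv.add c 0 p p hp hp
  | add f g hf hg => rw [add_mul]; exact pc_add_or F n Q _ _ hf hg
  | mul_X f i hf =>
    have hcomm : f * X i * p = X i * (f * p) := by ring
    rw [hcomm]
    rcases hf with hf | hf
    · left; rw [hf, mul_zero]
    · right; exact PCDeriv.prod i _ hf

theorem pc_of_mem_span (F : Type*) [Field F] (n : ℕ) (Q : Finset (MvPolynomial (Fin n) F))
    (p : MvPolynomial (Fin n) F)
    (hp : p ∈ Ideal.span ((Q : Set (MvPolynomial (Fin n) F)) ∪
        Set.range (fun i : Fin n => X i * (1 - X i)))) : p = 0 ∨ PCDeriv F n Q p := by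
  induction hp using Submodule.span_induction with
  | mem x hx =>
    right
    rcases hx with hx | ⟨i, rfl⟩
    · exact PCDeriv.hyp x hx
    · exact PCDeriv.boolAx i
  | zero => left; rfl
  | add x y _ _ hx hy => exact pc_add_or F n Q x y hx hy
  | smul a x _ hx => exact pc_mul_or F n Q a x hx

/-- **Soundness and completeness of the Polynomial Calculus over the boolean cube.**
There is a PC refutation of `Q` (a PC derivation of `1` from `Q`) iff the polynomials of `Q`
have no common zero in `{0,1}ⁿ`. -/
theorem stmt_17 (F : Type*) [Field F] (n : ℕ) (Q : Finset (MvPolynomial (Fin n) F)) :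
    PCDeriv F n Q 1 ↔
      ¬ ∃ e : Fin n → F, (∀ i, e i = 0 ∨ e i = 1) ∧ ∀ f ∈ Q, eval e f = 0 := by
  constructor
  · rintro h ⟨e, he, hQ⟩
    have key : ∀ p, PCDeriv F n Q p → eval e p = 0 := by
      intro p hp
      induction hp with
      | hyp f hf => exact hQ f hf
      | boolAx i => rcases he i with h | h <;> simp [h]
      | prod i p _ ih => simp [ih]
      | add a b p q _ _ ih1 ih2 => simp [ih1, ih2]
    simpa using key 1 h
  · intro h
    by_contra h1
    apply h
    have hne : Ideal.span ((Q : Set (MvPolynomial (Fin n) F)) ∪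
        Set.range (fun i : Fin n => X i * (1 - X i))) ≠ ⊤ := by
      intro ht
      have h2 := (Ideal.eq_top_iff_one _).1 ht
      rcases pc_of_mem_span F n Q 1 h2 with h3 | h3
      · exact one_ne_zero h3
      · exact h1 h3
    obtain ⟨M, hM, hIM⟩ := Ideal.exists_le_maximal _ hne
    classical
    let e : Fin n → F := fun i => if (X i : MvPolynomial (Fin n) F) ∈ M then 0 else 1
    have hX : ∀ i, Ideal.Quotient.mk M (X i) = Ideal.Quotient.mk M (C (e i)) := by
      intro i
      by_cases hi : (X i : MvPolynomial (Fin n) F) ∈ M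
      · simpa [e, hi] using Ideal.Quotient.eq_zero_iff_mem.2 hi
      · have hm : (X i * (1 - X i) : MvPolynomial (Fin n) F) ∈ M :=
          hIM (Ideal.subset_span (Or.inr ⟨i, rfl⟩))
        have h4 := (hM.isPrime.mem_or_mem hm).resolve_left hi
        have h5 := Ideal.Quotient.eq.2 h4
        simpa [e, hi] using h5.symm
    have hhom : Ideal.Quotient.mk M = ((Ideal.Quotient.mk M).comp C).comp (eval e) := by
      apply MvPolynomial.ringHom_ext
      · intro r; simp
      · intro i; simpa using hX i
    refine ⟨e, fun i => ?_, fun f hf => ?_⟩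
    · by_cases hi : (X i : MvPolynomial (Fin n) F) ∈ M <;> simp [e, hi]
    · have hm : f ∈ M := hIM (Ideal.subset_span (Or.inl hf))
      have h6 := RingHom.congr_fun hhom f
      rw [Ideal.Quotient.eq_zero_iff_mem.2 hm] at h6
      by_contra hz
      have h7 : C (eval e f) ∈ M := Ideal.Quotient.eq_zero_iff_mem.1 h6.symm
      exact hM.ne_top (Ideal.eq_top_of_isUnit_mem _ h7 ((IsUnit.mk0 _ hz).map C))
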